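/- arXiv:2302.02841 — 8 statements merged into one kernel-verified Lean document; each statement's English description precedes it below -/
import Mathlib

section
/- Let H be a real inner product space, m ≥ 1 an integer, η : H × H → H a map, and S ⊆ H a nonempty set that is invex with respect to η. Let F : S × S → ℝ be bounded below on S × S and strongly geodesic preinvex of order m with modulus δ > 0 with respect to (η, η) in the pair of variables, i.e. for all u₀, u₁, v₀, v₁ ∈ S and s ∈ [0,1], F(u₁ + s·η(u₀,u₁), v₁ + s·η(v₀,v₁)) ≤ s·F(u₀,v₀) + (1−s)·F(u₁,v₁) − δ·s·(1−s)·(‖η(u₀,u₁)‖^m + ‖η(v₀,v₁)‖^m). Then the function Ψ : S → ℝ defined by Ψ(u) = inf_{v ∈ S} F(u,v) is strongly geodesic preinvex of order m with modulus δ with respect to η: for all u₀, u₁ ∈ S and s ∈ [0,1], Ψ(u₁ + s·η(u₀,u₁)) ≤ s·Ψ(u₀) + (1−s)·Ψ(u₁) − δ·s·(1−s)·‖η(u₀,u₁)‖^m. -/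
/-- If `F : S × S → ℝ` is bounded below and strongly geodesic preinvex of order `m`
with modulus `δ` with respect to `(η, η)` in the pair of variables, then
`Ψ u = inf_{v ∈ S} F u v` is strongly geodesic preinvex of order `m` with modulus `δ`. -/
theorem inf_strongly_geodesic_preinvex
    {H : Type*} [NormedAddCommGroup H] [InnerProductSpace ℝ H]
    (m : ℕ) (hm : 1 ≤ m) (η : H → H → H) (S : Set H) (hS : S.Nonempty)
    (hinvex : ∀ u ∈ S, ∀ v ∈ S, ∀ s ∈ Set.Icc (0 : ℝ) 1, v + s • η u v ∈ S)
    (F : H → H → ℝ) (δ : ℝ) (hδ : 0 < δ)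
    (hbdd : ∃ c : ℝ, ∀ u ∈ S, ∀ v ∈ S, c ≤ F u v)
    (hpre : ∀ u₀ ∈ S, ∀ u₁ ∈ S, ∀ v₀ ∈ S, ∀ v₁ ∈ S, ∀ s ∈ Set.Icc (0 : ℝ) 1,
      F (u₁ + s • η u₀ u₁) (v₁ + s • η v₀ v₁) ≤
        s * F u₀ v₀ + (1 - s) * F u₁ v₁ -
          δ * s * (1 - s) * (‖η u₀ u₁‖ ^ m + ‖η v₀ v₁‖ ^ m)) :
    ∀ u₀ ∈ S, ∀ u₁ ∈ S, ∀ s ∈ Set.Icc (0 : ℝ) 1,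
      sInf ((fun v => F (u₁ + s • η u₀ u₁) v) '' S) ≤
        s * sInf ((fun v => F u₀ v) '' S) + (1 - s) * sInf ((fun v => F u₁ v) '' S) -
          δ * s * (1 - s) * ‖η u₀ u₁‖ ^ m := by
  intro u₀ hu₀ u₁ hu₁ s hs
  obtain ⟨c, hc⟩ := hbdd
  refine le_of_forall_pos_le_add fun ε hε => ?_
  obtain ⟨_, ⟨v₀, hv₀, rfl⟩, h₀⟩ :=
    exists_lt_of_csInf_lt (hS.image fun v => F u₀ v) (lt_add_of_pos_right _ hε)
  obtain ⟨_, ⟨v₁, hv₁, rfl⟩, h₁⟩ :=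
    exists_lt_of_csInf_lt (hS.image fun v => F u₁ v) (lt_add_of_pos_right _ hε)
  have hle : sInf ((fun v => F (u₁ + s • η u₀ u₁) v) '' S) ≤
      F (u₁ + s • η u₀ u₁) (v₁ + s • η v₀ v₁) := by
    refine csInf_le ⟨c, ?_⟩ ⟨_, hinvex v₀ hv₀ v₁ hv₁ s hs, rfl⟩
    rintro _ ⟨v, hv, rfl⟩
    exact hc _ (hinvex u₀ hu₀ u₁ hu₁ s hs) v hv
  have hF := hpre u₀ hu₀ u₁ hu₁ v₀ hv₀ v₁ hv₁ s hs
  have hs₁ : 0 ≤ 1 - s := sub_nonneg.2 hs.2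
  have hpos : 0 ≤ δ * s * (1 - s) * ‖η v₀ v₁‖ ^ m :=
    mul_nonneg (mul_nonneg (mul_nonneg hδ.le hs.1) hs₁) (by positivity)
  have hm₀ := mul_le_mul_of_nonneg_left h₀.le hs.1
  have hm₁ := mul_le_mul_of_nonneg_left h₁.le hs₁
  linarith
end

section
/- Let H be a real inner product space, m ≥ 1 an integer, η : H × H → H a map, and S ⊆ H a nonempty open set that is invex with respect to η. Let h : S → ℝ be differentiable on S. If h is strongly geodesic preinvex of order m with modulus δ > 0 with respect to η, then h is strongly η-invex of order m with the same modulus δ: for all u, v ∈ S, h(u) ≥ h(v) + Dh(v)(η(u,v)) + δ·‖η(u,v)‖^m, where Dh(v) denotes the Fréchet derivative of h at v. -/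
/-- A differentiable strongly geodesic preinvex function of order `m` with modulus
`δ` on an open invex set is strongly `η`-invex of order `m` with the same modulus. -/
theorem strongly_geodesic_preinvex_implies_strongly_invex
    {H : Type*} [NormedAddCommGroup H] [InnerProductSpace ℝ H]
    (m : ℕ) (hm : 1 ≤ m) (η : H → H → H) (S : Set H) (hS : S.Nonempty) (hopen : IsOpen S)
    (hinvex : ∀ u ∈ S, ∀ v ∈ S, ∀ s ∈ Set.Icc (0 : ℝ) 1, v + s • η u v ∈ S)
    (h : H → ℝ) (Dh : H → H →L[ℝ] ℝ)
    (hdiff : ∀ v ∈ S, HasFDerivAt h (Dh v) v)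
    (δ : ℝ) (hδ : 0 < δ)
    (hpre : ∀ u ∈ S, ∀ v ∈ S, ∀ s ∈ Set.Icc (0 : ℝ) 1,
      h (v + s • η u v) ≤ s * h u + (1 - s) * h v - δ * s * (1 - s) * ‖η u v‖ ^ m) :
    ∀ u ∈ S, ∀ v ∈ S, h v + Dh v (η u v) + δ * ‖η u v‖ ^ m ≤ h u := by
  intro u hu v hv
  have hslope := ((hdiff v hv).hasLineDerivAt (η u v)).tendsto_slope_zero_right
  have hbound : Filter.Tendsto (fun s : ℝ => h u - h v - δ * (1 - s) * ‖η u v‖ ^ m)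
      (nhdsWithin 0 (Set.Ioi 0)) (nhds (h u - h v - δ * (1 - 0) * ‖η u v‖ ^ m)) :=
    (Continuous.tendsto (by fun_prop) 0).mono_left nhdsWithin_le_nhds
  have hle : Dh v (η u v) ≤ h u - h v - δ * (1 - 0) * ‖η u v‖ ^ m := by
    refine le_of_tendsto_of_tendsto hslope hbound ?_
    filter_upwards [Ioo_mem_nhdsGT (zero_lt_one' ℝ)] with s hs
    rw [smul_eq_mul, inv_mul_le_iff₀ hs.1]
    linarith [hpre u hu v hv s ⟨hs.1.le, hs.2.le⟩]
  linarith
end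

section
/- Let H be a real inner product space, m ≥ 1 an integer, η : H × H → H a map, and S ⊆ H a nonempty open set that is invex with respect to η. Assume η satisfies Condition C on S: for all u, v ∈ S and s ∈ [0,1], η(v, v + s·η(u,v)) = −s·η(u,v) and η(u, v + s·η(u,v)) = (1−s)·η(u,v). Let h : S → ℝ be differentiable on S and strongly η-invex of order m with modulus δ > 0. Then h is strongly geodesic preinvex of order m with respect to η with modulus δ' = δ·2^{2−m}: for all u, v ∈ S and s ∈ [0,1], h(v + s·η(u,v)) ≤ s·h(u) + (1−s)·h(v) − δ'·s·(1−s)·‖η(u,v)‖^m. -/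
/-- The power mean inequality for two nonnegative weights summing to one. -/
theorem two_zpow_le_pow_add_one_sub_pow {s : ℝ} (h0 : 0 ≤ s) (h1 : s ≤ 1) (k : ℕ) :
    (2 : ℝ) ^ ((1 : ℤ) - k) ≤ (1 - s) ^ k + s ^ k := by
  rcases k with _ | j
  · norm_num
  · have hp := add_pow_le (sub_nonneg.2 h1) h0 (j + 1)
    have e : (1 : ℤ) - ((j + 1 : ℕ) : ℤ) = -(j : ℤ) := by push_cast; ring
    rw [e, zpow_neg, zpow_natCast, inv_le_iff_one_le_mul₀' (by positivity)]
    simpa using hp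

/-- A differentiable strongly `η`-invex function of order `m` with modulus `δ` on an
open invex set, with `η` satisfying Condition C, is strongly geodesic preinvex of order `m` with
modulus `δ' = δ * 2 ^ (2 - m)`. -/
theorem strongly_invex_implies_strongly_geodesic_preinvex
    {H : Type*} [NormedAddCommGroup H] [InnerProductSpace ℝ H]
    (m : ℕ) (hm : 1 ≤ m) (η : H → H → H) (S : Set H) (hS : S.Nonempty) (hopen : IsOpen S)
    (hinvex : ∀ u ∈ S, ∀ v ∈ S, ∀ s ∈ Set.Icc (0 : ℝ) 1, v + s • η u v ∈ S)
    (hC1 : ∀ u ∈ S, ∀ v ∈ S, ∀ s ∈ Set.Icc (0 : ℝ) 1,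
      η v (v + s • η u v) = -(s • η u v))
    (hC2 : ∀ u ∈ S, ∀ v ∈ S, ∀ s ∈ Set.Icc (0 : ℝ) 1,
      η u (v + s • η u v) = (1 - s) • η u v)
    (h : H → ℝ) (Dh : H → H →L[ℝ] ℝ)
    (hdiff : ∀ v ∈ S, HasFDerivAt h (Dh v) v)
    (δ : ℝ) (hδ : 0 < δ)
    (hinv : ∀ u ∈ S, ∀ v ∈ S, h v + Dh v (η u v) + δ * ‖η u v‖ ^ m ≤ h u) :
    ∀ u ∈ S, ∀ v ∈ S, ∀ s ∈ Set.Icc (0 : ℝ) 1,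
      h (v + s • η u v) ≤ s * h u + (1 - s) * h v -
        (δ * (2 : ℝ) ^ ((2 : ℤ) - m)) * s * (1 - s) * ‖η u v‖ ^ m := by
  intro u hu v hv s hs
  obtain ⟨k, rfl⟩ : ∃ k, m = k + 1 := ⟨m - 1, by omega⟩
  have hw := hinvex u hu v hv s hs
  have hu' := hinv u hu _ hw
  have hv' := hinv v hv _ hw
  rw [hC2 u hu v hv s hs] at hu'
  rw [hC1 u hu v hv s hs] at hv'
  obtain ⟨h0, h1⟩ := hs
  have h1' : 0 ≤ 1 - s := sub_nonneg.2 h1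
  rw [map_smul, smul_eq_mul, norm_smul, Real.norm_of_nonneg h1', mul_pow] at hu'
  rw [map_neg, map_smul, smul_eq_mul, norm_neg, norm_smul, Real.norm_of_nonneg h0,
    mul_pow] at hv'
  have e : (2 : ℤ) - ((k + 1 : ℕ) : ℤ) = 1 - k := by push_cast; ring
  rw [e]
  have hp := mul_le_mul_of_nonneg_left (two_zpow_le_pow_add_one_sub_pow h0 h1 k)
    (by positivity : 0 ≤ δ * s * (1 - s) * ‖η u v‖ ^ (k + 1))
  have hus := mul_le_mul_of_nonneg_left hu' h0
  have hvs := mul_le_mul_of_nonneg_left hv' h1'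
  rw [pow_succ (1 - s)] at hus
  rw [pow_succ s] at hvs
  linarith
end

section
/- Let H be a real inner product space, m ≥ 1 an integer, η : H × H → H a map, and S ⊆ H a nonempty open set that is invex with respect to η. Assume η satisfies Condition C on S: for all u, v ∈ S and s ∈ [0,1], η(v, v + s·η(u,v)) = −s·η(u,v) and η(u, v + s·η(u,v)) = (1−s)·η(u,v). Let h : S → ℝ be differentiable on S and strongly η-invex of order m with modulus δ > 0. Then for all u, v ∈ S and all s ∈ [0,1], h(v + s·η(u,v)) + δ·s·(1−s)·((1−s)^{m−1} + s^{m−1})·‖η(u,v)‖^m ≤ s·h(u) + (1−s)·h(v). -/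
/-- Key inequality: for a differentiable strongly `η`-invex function of order `m`
with modulus `δ` on an open invex set, with `η` satisfying Condition C,
`h(v + s·η(u,v)) + δ·s·(1−s)·((1−s)^{m−1} + s^{m−1})·‖η(u,v)‖^m ≤ s·h(u) + (1−s)·h(v)`. -/
theorem strongly_invex_key_inequality
    {H : Type*} [NormedAddCommGroup H] [InnerProductSpace ℝ H]
    (m : ℕ) (hm : 1 ≤ m) (η : H → H → H) (S : Set H) (hS : S.Nonempty) (hopen : IsOpen S)
    (hinvex : ∀ u ∈ S, ∀ v ∈ S, ∀ s ∈ Set.Icc (0 : ℝ) 1, v + s • η u v ∈ S)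
    (hC1 : ∀ u ∈ S, ∀ v ∈ S, ∀ s ∈ Set.Icc (0 : ℝ) 1,
      η v (v + s • η u v) = -(s • η u v))
    (hC2 : ∀ u ∈ S, ∀ v ∈ S, ∀ s ∈ Set.Icc (0 : ℝ) 1,
      η u (v + s • η u v) = (1 - s) • η u v)
    (h : H → ℝ) (Dh : H → H →L[ℝ] ℝ)
    (hdiff : ∀ v ∈ S, HasFDerivAt h (Dh v) v)
    (δ : ℝ) (hδ : 0 < δ)
    (hinv : ∀ u ∈ S, ∀ v ∈ S, h v + Dh v (η u v) + δ * ‖η u v‖ ^ m ≤ h u) :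
    ∀ u ∈ S, ∀ v ∈ S, ∀ s ∈ Set.Icc (0 : ℝ) 1,
      h (v + s • η u v) +
          δ * s * (1 - s) * ((1 - s) ^ (m - 1) + s ^ (m - 1)) * ‖η u v‖ ^ m ≤
        s * h u + (1 - s) * h v := by
  rintro u hu v hv s ⟨hs0, hs1⟩
  obtain ⟨k, rfl⟩ := Nat.exists_eq_add_of_le' hm
  have hw := hinvex u hu v hv s ⟨hs0, hs1⟩
  have hu_ineq := hinv u hu _ hw
  have hv_ineq := hinv v hv _ hw
  rw [hC2 u hu v hv s ⟨hs0, hs1⟩, map_smul, norm_smul, Real.norm_of_nonneg (sub_nonneg.2 hs1),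
    mul_pow, smul_eq_mul] at hu_ineq
  rw [hC1 u hu v hv s ⟨hs0, hs1⟩, map_neg, map_smul, norm_neg, norm_smul,
    Real.norm_of_nonneg hs0, mul_pow, smul_eq_mul] at hv_ineq
  have hsu := mul_le_mul_of_nonneg_left hu_ineq hs0
  have hsv := mul_le_mul_of_nonneg_left hv_ineq (sub_nonneg.2 hs1)
  rw [Nat.add_sub_cancel]
  rw [pow_succ (1 - s)] at hsu
  rw [pow_succ s] at hsv
  linear_combination hsu + hsv
end

section
/- Let H be a real inner product space, m ≥ 1 an integer, η : H × H → H a map, and S ⊆ H a nonempty open set that is invex with respect to η. Assume η satisfies Condition C on S: for all u, v ∈ S and s ∈ [0,1], η(v, v + s·η(u,v)) = −s·η(u,v) and η(u, v + s·η(u,v)) = (1−s)·η(u,v). Let h : S → ℝ be differentiable on S. Then h is strongly geodesic preinvex of order m with respect to η for some modulus δ' > 0 if and only if h is strongly η-invex of order m for some modulus δ > 0. -/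
open Filter Topology in
/-- Differentiating at `s = 0` a strong convexity-type upper bound along the segment from `v`
in direction `e` gives the corresponding first-order inequality. -/
theorem HasFDerivAt.add_mul_le_of_le_along_segment
    {E : Type*} [NormedAddCommGroup E] [NormedSpace ℝ E] {h : E → ℝ} {h' : E →L[ℝ] ℝ}
    {v e : E} {a δ c : ℝ} (hh : HasFDerivAt h h' v)
    (hle : ∀ s ∈ Set.Icc (0 : ℝ) 1,
      h (v + s • e) ≤ s * a + (1 - s) * h v - δ * s * (1 - s) * c) :
    h' e + δ * c ≤ a - h v := by
  have hlim : Tendsto (fun s : ℝ => s⁻¹ • (h (v + s • e) - h v)) (𝓝[>] 0) (𝓝 (h' e)) := by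
    have := (hh.hasLineDerivAt e).tendsto_slope_zero_right
    simpa using this
  have hbound : Tendsto (fun s : ℝ => a - h v - δ * (1 - s) * c) (𝓝[>] 0)
      (𝓝 (a - h v - δ * (1 - 0) * c)) :=
    (Continuous.tendsto (by fun_prop) 0).mono_left nhdsWithin_le_nhds
  have key := le_of_tendsto_of_tendsto hlim hbound (by
    filter_upwards [Ioc_mem_nhdsGT (zero_lt_one' ℝ)] with s hs
    rw [smul_eq_mul, inv_mul_le_iff₀ hs.1]
    linarith [hle s ⟨hs.1.le, hs.2⟩])
  linarith

theorem half_pow_le_pow_add_one_sub_pow (k : ℕ) {s : ℝ} (hs : s ∈ Set.Icc (0 : ℝ) 1) :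
    (1 / 2 : ℝ) ^ k ≤ s ^ k + (1 - s) ^ k := by
  have h0 : 0 ≤ s ^ k := pow_nonneg hs.1 k
  have h1 : 0 ≤ (1 - s) ^ k := pow_nonneg (sub_nonneg.2 hs.2) k
  rcases le_total (1 / 2) s with h | h
  · linarith [pow_le_pow_left₀ (by norm_num) h k]
  · linarith [pow_le_pow_left₀ (by norm_num) (show (1 / 2 : ℝ) ≤ 1 - s by linarith) k]

/-- With `η` satisfying Condition C on an open invex set `S`, a differentiable
function `h` is strongly geodesic preinvex of order `m` (for some modulus) iff it is strongly
`η`-invex of order `m` (for some modulus). -/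
theorem strongly_geodesic_preinvex_iff_strongly_invex
    {H : Type*} [NormedAddCommGroup H] [InnerProductSpace ℝ H]
    (m : ℕ) (hm : 1 ≤ m) (η : H → H → H) (S : Set H) (hS : S.Nonempty) (hopen : IsOpen S)
    (hinvex : ∀ u ∈ S, ∀ v ∈ S, ∀ s ∈ Set.Icc (0 : ℝ) 1, v + s • η u v ∈ S)
    (hC1 : ∀ u ∈ S, ∀ v ∈ S, ∀ s ∈ Set.Icc (0 : ℝ) 1,
      η v (v + s • η u v) = -(s • η u v))
    (hC2 : ∀ u ∈ S, ∀ v ∈ S, ∀ s ∈ Set.Icc (0 : ℝ) 1,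
      η u (v + s • η u v) = (1 - s) • η u v)
    (h : H → ℝ) (Dh : H → H →L[ℝ] ℝ)
    (hdiff : ∀ v ∈ S, HasFDerivAt h (Dh v) v) :
    (∃ δ' : ℝ, 0 < δ' ∧ ∀ u ∈ S, ∀ v ∈ S, ∀ s ∈ Set.Icc (0 : ℝ) 1,
        h (v + s • η u v) ≤ s * h u + (1 - s) * h v - δ' * s * (1 - s) * ‖η u v‖ ^ m) ↔
      (∃ δ : ℝ, 0 < δ ∧ ∀ u ∈ S, ∀ v ∈ S,
        h v + Dh v (η u v) + δ * ‖η u v‖ ^ m ≤ h u) := by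
  constructor
  · rintro ⟨δ, hδ, hpre⟩
    refine ⟨δ, hδ, fun u hu v hv => ?_⟩
    have key := HasFDerivAt.add_mul_le_of_le_along_segment (hdiff v hv) (hpre u hu v hv)
    linarith
  · rintro ⟨δ, hδ, hinv⟩
    refine ⟨δ * (1 / 2) ^ (m - 1), by positivity, fun u hu v hv s hs => ?_⟩
    have hx := hinvex u hu v hv s hs
    have hs0 : 0 ≤ s := hs.1
    have hs1 : 0 ≤ 1 - s := sub_nonneg.2 hs.2
    have hv' := hinv v hv _ hx
    have hu' := hinv u hu _ hx
    rw [hC1 u hu v hv s hs, map_neg, map_smul, norm_neg, norm_smul, Real.norm_of_nonneg hs0,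
      mul_pow, smul_eq_mul] at hv'
    rw [hC2 u hu v hv s hs, map_smul, norm_smul, Real.norm_of_nonneg hs1, mul_pow,
      smul_eq_mul] at hu'
    obtain ⟨k, rfl⟩ : ∃ k, m = k + 1 := ⟨m - 1, by omega⟩
    rw [Nat.add_sub_cancel]
    have hk := half_pow_le_pow_add_one_sub_pow k hs
    have hu'' := mul_le_mul_of_nonneg_left hu' hs0
    have hv'' := mul_le_mul_of_nonneg_left hv' hs1
    have hc : 0 ≤ δ * s * (1 - s) * ‖η u v‖ ^ (k + 1) := by positivity
    have hk' := mul_le_mul_of_nonneg_left hk hc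
    rw [pow_succ s, pow_succ (1 - s)] at *
    linarith
end

section
/- Let H be a real inner product space, m ≥ 1 an integer, and η : H × H → H a map satisfying property (P) along straight lines: for all u, v ∈ H and all s, t ∈ [0,1], η(v + s·η(u,v), v + t·η(u,v)) = (s−t)·η(u,v). Let h : H → ℝ be differentiable with gradient ∇h. If ∇h is strongly invariant η-monotone of order m with modulus δ > 0, then there exists δ' > 0 such that for all u, v ∈ H, h(v + η(u,v)) ≥ h(v) + ⟨∇h(v), η(u,v)⟩ + δ'·‖η(u,v)‖^m (one may take δ' = δ·2^{1−m}). -/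
open RealInnerProductSpace

/-- If `η` satisfies property (P) along straight lines and the gradient `G` of a
differentiable function `h` is strongly invariant `η`-monotone of order `m` with modulus `δ`,
then there exists `δ' > 0` with
`h(v + η(u,v)) ≥ h(v) + ⟪G v, η(u,v)⟫ + δ'·‖η(u,v)‖^m` for all `u, v`. -/
theorem strongly_invariant_monotone_implies_strongly_invex
    {H : Type*} [NormedAddCommGroup H] [InnerProductSpace ℝ H]
    (m : ℕ) (hm : 1 ≤ m) (η : H → H → H)
    (hP : ∀ u v : H, ∀ s ∈ Set.Icc (0 : ℝ) 1, ∀ t ∈ Set.Icc (0 : ℝ) 1,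
      η (v + s • η u v) (v + t • η u v) = (s - t) • η u v)
    (h : H → ℝ) (G : H → H)
    (hgrad : ∀ v : H, HasFDerivAt h (innerSL ℝ (G v)) v)
    (δ : ℝ) (hδ : 0 < δ)
    (hmono : ∀ u v : H,
      ⟪G v, η u v⟫ + ⟪G u, η v u⟫ ≤ -δ * (‖η u v‖ ^ m + ‖η v u‖ ^ m)) :
    ∃ δ' : ℝ, 0 < δ' ∧ ∀ u v : H,
      h v + ⟪G v, η u v⟫ + δ' * ‖η u v‖ ^ m ≤ h (v + η u v) := by
  have hm0 : (0 : ℝ) < m := by exact_mod_cast hm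
  refine ⟨2 * δ / m, by positivity, fun u v => ?_⟩
  set e := η u v
  have slope : ∀ s ∈ Set.Ioo (0 : ℝ) 1,
      ⟪G v, e⟫ + 2 * δ * s ^ (m - 1) * ‖e‖ ^ m ≤ ⟪G (v + s • e), e⟫ := by
    intro s hs
    have hs' : s ∈ Set.Icc (0 : ℝ) 1 := Set.Ioo_subset_Icc_self hs
    have h0 : (0 : ℝ) ∈ Set.Icc (0 : ℝ) 1 := by simp
    have h1 : η (v + s • e) v = s • e := by simpa using hP u v s hs' 0 h0
    have h2 : η v (v + s • e) = -(s • e) := by simpa using hP u v 0 h0 s hs'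
    have h3 := hmono (v + s • e) v
    rw [h1, h2, norm_neg, inner_neg_right, real_inner_smul_right, real_inner_smul_right,
      norm_smul, Real.norm_of_nonneg hs.1.le, mul_pow, ← mul_pow_sub_one (by omega : m ≠ 0) s] at h3
    refine le_of_mul_le_mul_left ?_ hs.1
    linarith
  have deriv_path : ∀ s : ℝ, HasDerivAt
      (fun s : ℝ => h (v + s • e) - s * ⟪G v, e⟫ - 2 * δ / m * ‖e‖ ^ m * s ^ m)
      (⟪G (v + s • e), e⟫ - ⟪G v, e⟫ - 2 * δ / m * ‖e‖ ^ m * (m * s ^ (m - 1))) s := by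
    intro s
    have hline : HasDerivAt (fun s : ℝ => v + s • e) e s := by
      simpa using ((hasDerivAt_id s).smul_const e).const_add v
    have hlin : HasDerivAt (fun s : ℝ => s * ⟪G v, e⟫) ⟪G v, e⟫ s := by
      simpa using (hasDerivAt_id s).mul_const ⟪G v, e⟫
    exact (((hgrad (v + s • e)).comp_hasDerivAt s hline).sub hlin).sub
      ((hasDerivAt_pow m s).const_mul _)
  have mono : MonotoneOn
      (fun s : ℝ => h (v + s • e) - s * ⟪G v, e⟫ - 2 * δ / m * ‖e‖ ^ m * s ^ m)
      (Set.Icc 0 1) := by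
    refine monotoneOn_of_deriv_nonneg (convex_Icc 0 1)
      (fun s _ => (deriv_path s).continuousAt.continuousWithinAt)
      (fun s _ => (deriv_path s).differentiableAt.differentiableWithinAt) fun s hs => ?_
    rw [interior_Icc] at hs
    rw [(deriv_path s).deriv]
    have hcancel : 2 * δ / m * ‖e‖ ^ m * (m * s ^ (m - 1)) = 2 * δ * s ^ (m - 1) * ‖e‖ ^ m := by
      field_simp
    linarith [slope s hs]
  have key := mono (by simp : (0 : ℝ) ∈ Set.Icc (0 : ℝ) 1)
    (by simp : (1 : ℝ) ∈ Set.Icc (0 : ℝ) 1) zero_le_one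
  simp only [zero_smul, add_zero, zero_mul, sub_zero, zero_pow (by omega : m ≠ 0), mul_zero,
    one_smul, one_mul, one_pow, mul_one] at key
  linarith
end

section
/- Let H be a real inner product space, m ≥ 1 an integer, and η : H × H → H a map satisfying property (P) along straight lines: for all u, v ∈ H and all s, t ∈ [0,1], η(v + s·η(u,v), v + t·η(u,v)) = (s−t)·η(u,v). Let h : H → ℝ be differentiable with gradient ∇h. If ∇h is strongly invariant pseudo η-monotone of order m with modulus δ > 0, then there exists δ' > 0 such that h is strongly pseudo η-invex of order m along η-segments: for all u, v ∈ H, if ⟨∇h(v), η(u,v)⟩ ≥ 0 then h(v + η(u,v)) ≥ h(v) + δ'·‖η(u,v)‖^m (one may take δ' = δ·2^{−m}). -/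
open RealInnerProductSpace

/-- If `η` satisfies property (P) along straight lines and the gradient `G` of a
differentiable function `h` is strongly invariant pseudo `η`-monotone of order `m` with modulus
`δ`, then there exists `δ' > 0` such that for all `u, v`, `⟪G v, η(u,v)⟫ ≥ 0` implies
`h(v + η(u,v)) ≥ h(v) + δ'·‖η(u,v)‖^m`. -/
theorem strongly_invariant_pseudo_monotone_implies_strongly_pseudo_invex
    {H : Type*} [NormedAddCommGroup H] [InnerProductSpace ℝ H]
    (m : ℕ) (hm : 1 ≤ m) (η : H → H → H)
    (hP : ∀ u v : H, ∀ s ∈ Set.Icc (0 : ℝ) 1, ∀ t ∈ Set.Icc (0 : ℝ) 1,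
      η (v + s • η u v) (v + t • η u v) = (s - t) • η u v)
    (h : H → ℝ) (G : H → H)
    (hgrad : ∀ v : H, HasFDerivAt h (innerSL ℝ (G v)) v)
    (δ : ℝ) (hδ : 0 < δ)
    (hmono : ∀ u v : H, 0 ≤ ⟪G u, η v u⟫ → ⟪G v, η u v⟫ ≤ -δ * ‖η u v‖ ^ m) :
    ∃ δ' : ℝ, 0 < δ' ∧ ∀ u v : H,
      0 ≤ ⟪G v, η u v⟫ → h v + δ' * ‖η u v‖ ^ m ≤ h (v + η u v) := by
  have hm0 : (0 : ℝ) < m := by exact_mod_cast hm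
  refine ⟨δ / m, by positivity, fun u v hv => ?_⟩
  have hderiv_ge (s : ℝ) (hs : 0 < s) (hs1 : s ≤ 1) :
      δ * ‖η u v‖ ^ m * s ^ (m - 1) ≤ ⟪G (v + s • η u v), η u v⟫ := by
    have h₀ : (0 : ℝ) ∈ Set.Icc (0 : ℝ) 1 := by simp
    have hback := hP u v 0 h₀ s ⟨hs.le, hs1⟩
    have hforth := hP u v s ⟨hs.le, hs1⟩ 0 h₀
    simp only [zero_smul, add_zero, sub_zero, zero_sub] at hback hforth
    have hineq := hmono v (v + s • η u v) (by
      rw [hforth, real_inner_smul_right]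
      positivity)
    rw [hback, real_inner_smul_right, norm_smul, norm_neg, Real.norm_of_nonneg hs.le,
      mul_pow, ← Nat.sub_add_cancel hm, pow_succ s, Nat.sub_add_cancel hm] at hineq
    refine le_of_mul_le_mul_left ?_ hs
    linarith
  have hderiv (s : ℝ) : HasDerivAt
      (fun s : ℝ => h (v + s • η u v) - δ * ‖η u v‖ ^ m / m * s ^ m)
      (⟪G (v + s • η u v), η u v⟫ - δ * ‖η u v‖ ^ m * s ^ (m - 1)) s := by
    have hline : HasDerivAt (fun s : ℝ => v + s • η u v) (η u v) s := by
      simpa using ((hasDerivAt_id s).smul_const (η u v)).const_add v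
    have hcomp := (hgrad (v + s • η u v)).comp_hasDerivAt s hline
    have hpow := (hasDerivAt_pow m s).const_mul (δ * ‖η u v‖ ^ m / m)
    refine (hcomp.sub hpow).congr_deriv ?_
    rw [innerSL_apply_apply]
    field_simp
  have hmonotone : MonotoneOn
      (fun s : ℝ => h (v + s • η u v) - δ * ‖η u v‖ ^ m / m * s ^ m) (Set.Icc 0 1) := by
    refine monotoneOn_of_deriv_nonneg (convex_Icc 0 1)
      (fun s _ => (hderiv s).continuousAt.continuousWithinAt)
      (fun s _ => (hderiv s).differentiableAt.differentiableWithinAt) fun s hs => ?_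
    rw [interior_Icc] at hs
    rw [(hderiv s).deriv, sub_nonneg]
    exact hderiv_ge s hs.1 hs.2.le
  have hle := hmonotone (Set.left_mem_Icc.2 zero_le_one) (Set.right_mem_Icc.2 zero_le_one)
    zero_le_one
  simp only [zero_smul, add_zero, one_smul, one_pow, mul_one,
    zero_pow (Nat.one_le_iff_ne_zero.1 hm), mul_zero, sub_zero] at hle
  rw [div_mul_eq_mul_div]
  linarith
end

section
/- Let H be a real inner product space, m ≥ 1 an integer, and η : H × H → H a map. Let h₁, …, h_k : H → ℝ (k ≥ 1) be differentiable functions with gradients ∇h₁, …, ∇h_k, and suppose each h_i is strongly η-invex of order m with modulus δ_i > 0. Let u* ∈ H be a solution of the vector variational-like inequality problem (VVLIP), i.e. there is no u ∈ H with ⟨∇h_i(u*), η(u,u*)⟩ < 0 for every i = 1, …, k. Then u* is a strict η-minimizer of order m for the multi-objective problem Min (h₁, …, h_k): there exists δ > 0 (one may take δ = min_i δ_i) such that there is no u ∈ H with h_i(u) < h_i(u*) + δ·‖η(u,u*)‖^m for every i = 1, …, k. -/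
open RealInnerProductSpace

/-- If `h₁, …, h_k` are strongly `η`-invex of order `m` with moduli `δ i > 0` and
`u*` solves the vector variational-like inequality problem, then `u*` is a strict `η`-minimizer
of order `m` for the multi-objective problem. -/
theorem VVLIP_solution_implies_strict_eta_minimizer
    {H : Type*} [NormedAddCommGroup H] [InnerProductSpace ℝ H]
    (m : ℕ) (hm : 1 ≤ m) (η : H → H → H)
    (k : ℕ) (hk : 0 < k) (h : Fin k → H → ℝ) (G : Fin k → H → H)
    (hgrad : ∀ i : Fin k, ∀ v : H, HasFDerivAt (h i) (innerSL ℝ (G i v)) v)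
    (δ : Fin k → ℝ) (hδ : ∀ i, 0 < δ i)
    (hinv : ∀ i : Fin k, ∀ u v : H,
      h i v + ⟪G i v, η u v⟫ + δ i * ‖η u v‖ ^ m ≤ h i u)
    (ustar : H)
    (hsol : ¬ ∃ u : H, ∀ i : Fin k, ⟪G i ustar, η u ustar⟫ < 0) :
    ∃ d : ℝ, 0 < d ∧
      ¬ ∃ u : H, ∀ i : Fin k, h i u < h i ustar + d * ‖η u ustar‖ ^ m := by
  have : Nonempty (Fin k) := ⟨⟨0, hk⟩⟩
  obtain ⟨j, hj⟩ := Finite.exists_min δ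
  refine ⟨δ j, hδ j, fun ⟨u, hu⟩ => hsol ⟨u, fun i => ?_⟩⟩
  have hmono : δ j * ‖η u ustar‖ ^ m ≤ δ i * ‖η u ustar‖ ^ m := by
    gcongr
    exact hj i
  linarith [hinv i u ustar, hu i]
end
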